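/- arXiv:2009.09886 — 10 statements merged into one kernel-verified Lean document; each statement's English description precedes it below -/
import Mathlib

section
/- Converse part of Sklar's theorem: let C be a two-dimensional copula and let F, G : ℝ → [0,1] be distribution functions (nondecreasing, right-continuous, tending to 0 at −∞ and to 1 at +∞). Define H(x,y) = C(F(x), G(y)). Then H is nondecreasing in each argument, satisfies the rectangle inequality H(x₂,y₂) − H(x₂,y₁) − H(x₁,y₂) + H(x₁,y₁) ≥ 0 for all x₁ ≤ x₂ and y₁ ≤ y₂, and has margins F and G in the sense that H(x,y) → F(x) as y → +∞, H(x,y) → G(y) as x → +∞, and H(x,y) → 0 as x → −∞ (and as y → −∞). -/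
open Set Filter

/-- Converse part of Sklar's theorem: if `C` is a two-dimensional copula and `F`, `G` are
distribution functions, then `H(x,y) = C (F x) (G y)` is nondecreasing in each argument,
satisfies the rectangle (2-increasing) inequality, and has margins `F` and `G`:
`H(x,y) → F x` as `y → ∞`, `H(x,y) → G y` as `x → ∞`, and `H(x,y) → 0` as either
argument tends to `-∞`. -/
theorem sklar_converse (C : ℝ → ℝ → ℝ)
    (hrange : ∀ a ∈ Icc (0:ℝ) 1, ∀ b ∈ Icc (0:ℝ) 1, C a b ∈ Icc (0:ℝ) 1)
    (hground : ∀ a ∈ Icc (0:ℝ) 1, C a 0 = 0 ∧ C 0 a = 0)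
    (hmargin : ∀ a ∈ Icc (0:ℝ) 1, C a 1 = a ∧ C 1 a = a)
    (hincr : ∀ a₁ ∈ Icc (0:ℝ) 1, ∀ a₂ ∈ Icc (0:ℝ) 1, ∀ b₁ ∈ Icc (0:ℝ) 1, ∀ b₂ ∈ Icc (0:ℝ) 1,
      a₁ ≤ a₂ → b₁ ≤ b₂ → 0 ≤ C a₂ b₂ - C a₂ b₁ - C a₁ b₂ + C a₁ b₁)
    (F G : ℝ → ℝ)
    (hFmono : Monotone F) (hFrc : ∀ x, ContinuousWithinAt F (Ici x) x)
    (hFbot : Tendsto F atBot (nhds 0)) (hFtop : Tendsto F atTop (nhds 1))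
    (hFrange : ∀ x, F x ∈ Icc (0:ℝ) 1)
    (hGmono : Monotone G) (hGrc : ∀ y, ContinuousWithinAt G (Ici y) y)
    (hGbot : Tendsto G atBot (nhds 0)) (hGtop : Tendsto G atTop (nhds 1))
    (hGrange : ∀ y, G y ∈ Icc (0:ℝ) 1)
    (H : ℝ → ℝ → ℝ) (hH : ∀ x y, H x y = C (F x) (G y)) :
    (∀ y, Monotone fun x => H x y) ∧
    (∀ x, Monotone fun y => H x y) ∧
    (∀ x₁ x₂ y₁ y₂, x₁ ≤ x₂ → y₁ ≤ y₂ →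
      0 ≤ H x₂ y₂ - H x₂ y₁ - H x₁ y₂ + H x₁ y₁) ∧
    (∀ x, Tendsto (fun y => H x y) atTop (nhds (F x))) ∧
    (∀ y, Tendsto (fun x => H x y) atTop (nhds (G y))) ∧
    (∀ y, Tendsto (fun x => H x y) atBot (nhds 0)) ∧
    (∀ x, Tendsto (fun y => H x y) atBot (nhds 0)) := by
  have h0 : (0 : ℝ) ∈ Icc (0 : ℝ) 1 := ⟨le_rfl, zero_le_one⟩
  have h1 : (1 : ℝ) ∈ Icc (0 : ℝ) 1 := ⟨zero_le_one, le_rfl⟩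
  have upper_left : ∀ x y, H x y ≤ F x := fun x y => by
    have h := hincr 0 h0 _ (hFrange x) _ (hGrange y) 1 h1 (hFrange x).1 (hGrange y).2
    rw [(hmargin _ (hFrange x)).1, (hground 1 h1).2, (hground _ (hGrange y)).2] at h
    rw [hH]
    linarith
  have upper_right : ∀ x y, H x y ≤ G y := fun x y => by
    have h := hincr _ (hFrange x) 1 h1 0 h0 _ (hGrange y) (hFrange x).2 (hGrange y).1
    rw [(hmargin _ (hGrange y)).2, (hground 1 h1).1, (hground _ (hFrange x)).1] at h
    rw [hH]
    linarith
  have lower : ∀ x y, F x + G y - 1 ≤ H x y := fun x y => by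
    have h := hincr _ (hFrange x) 1 h1 _ (hGrange y) 1 h1 (hFrange x).2 (hGrange y).2
    rw [(hmargin 1 h1).1, (hmargin _ (hGrange y)).2, (hmargin _ (hFrange x)).1] at h
    rw [hH]
    linarith
  have nonneg : ∀ x y, 0 ≤ H x y := fun x y => by
    rw [hH]
    exact (hrange _ (hFrange x) _ (hGrange y)).1
  refine ⟨fun y x₁ x₂ hx => ?_, fun x y₁ y₂ hy => ?_, fun x₁ x₂ y₁ y₂ hx hy => ?_,
    fun x => ?_, fun y => ?_, fun y => ?_, fun x => ?_⟩
  · have h := hincr _ (hFrange x₁) _ (hFrange x₂) 0 h0 _ (hGrange y) (hFmono hx) (hGrange y).1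
    rw [(hground _ (hFrange x₁)).1, (hground _ (hFrange x₂)).1] at h
    simp only [hH]
    linarith
  · have h := hincr 0 h0 _ (hFrange x) _ (hGrange y₁) _ (hGrange y₂) (hFrange x).1 (hGmono hy)
    rw [(hground _ (hGrange y₁)).2, (hground _ (hGrange y₂)).2] at h
    simp only [hH]
    linarith
  · simp only [hH]
    exact hincr _ (hFrange x₁) _ (hFrange x₂) _ (hGrange y₁) _ (hGrange y₂) (hFmono hx) (hGmono hy)
  · have h : Tendsto (fun y => F x + G y - 1) atTop (nhds (F x)) := by
      simpa using (hGtop.const_add (F x)).sub_const 1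
    exact tendsto_of_tendsto_of_tendsto_of_le_of_le h tendsto_const_nhds (lower x) (upper_left x)
  · have h : Tendsto (fun x => F x + G y - 1) atTop (nhds (G y)) := by
      simpa using (hFtop.add_const (G y)).sub_const 1
    exact tendsto_of_tendsto_of_tendsto_of_le_of_le h tendsto_const_nhds
      (fun x => lower x y) (fun x => upper_right x y)
  · exact squeeze_zero (fun x => nonneg x y) (fun x => upper_left x y) hFbot
  · exact squeeze_zero (nonneg x) (upper_right x) hGbot
end

section
/- Lower bound on the CDF of a monotone function of two dependent random variables: let X and Y be random variables on a common probability space taking values in the non-negative reals, with CDFs F_X and F_Y, and let L : [0,∞) × [0,∞) → [0,∞) be continuous and nondecreasing in each argument. Then for every s ≥ 0, P(L(X,Y) ≤ s) ≥ sup over all pairs (x,y) with x,y ≥ 0 and L(x,y) = s of max(F_X(x) + F_Y(y) − 1, 0). -/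
open MeasureTheory Set

/-- The Fréchet lower bound on the probability of an intersection. -/
theorem measureReal_add_sub_one_le_measureReal_inter {Ω : Type*} [MeasurableSpace Ω]
    (μ : Measure Ω) [IsProbabilityMeasure μ] (A : Set Ω) {B : Set Ω} (hB : MeasurableSet B) :
    μ.real A + μ.real B - 1 ≤ μ.real (A ∩ B) := by
  linarith [measureReal_union_add_inter (μ := μ) (s := A) hB,
    measureReal_le_one (μ := μ) (s := A ∪ B)]

/-- Lower dependency bound on the CDF of a monotone function of two non-negative random
variables: for any `s ≥ 0` and any `x, y ≥ 0` with `L x y = s`,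
`max (F_X x + F_Y y - 1) 0 ≤ P(L(X,Y) ≤ s)`; hence `P(L(X,Y) ≤ s)` dominates the
supremum of these bounds over all pairs `(x, y)` on the level set `L(x,y) = s`. -/
theorem lower_bound_cdf_monotone_function {Ω : Type*} [MeasurableSpace Ω]
    (μ : Measure Ω) [IsProbabilityMeasure μ]
    (X Y : Ω → ℝ) (hX : Measurable X) (hY : Measurable Y)
    (hXpos : ∀ ω, 0 ≤ X ω) (hYpos : ∀ ω, 0 ≤ Y ω)
    (L : ℝ → ℝ → ℝ)
    (hLcont : ContinuousOn (fun p : ℝ × ℝ => L p.1 p.2) (Ici 0 ×ˢ Ici 0))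
    (hLmono₁ : ∀ x₁ x₂ y, 0 ≤ x₁ → x₁ ≤ x₂ → 0 ≤ y → L x₁ y ≤ L x₂ y)
    (hLmono₂ : ∀ x y₁ y₂, 0 ≤ x → 0 ≤ y₁ → y₁ ≤ y₂ → L x y₁ ≤ L x y₂)
    (hLpos : ∀ x y, 0 ≤ x → 0 ≤ y → 0 ≤ L x y)
    (s : ℝ) (hs : 0 ≤ s) :
    ∀ x y, 0 ≤ x → 0 ≤ y → L x y = s →
      max ((μ {ω | X ω ≤ x}).toReal + (μ {ω | Y ω ≤ y}).toReal - 1) 0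
        ≤ (μ {ω | L (X ω) (Y ω) ≤ s}).toReal := by
  intro x y hx hy hxy
  refine max_le ?_ ENNReal.toReal_nonneg
  refine (measureReal_add_sub_one_le_measureReal_inter μ {ω | X ω ≤ x}
    (measurableSet_le hY measurable_const)).trans (measureReal_mono ?_)
  rintro ω ⟨hXx, hYy⟩
  calc L (X ω) (Y ω) ≤ L x (Y ω) := hLmono₁ _ _ _ (hXpos ω) hXx (hYpos ω)
    _ ≤ L x y := hLmono₂ _ _ _ hx (hYpos ω) hYy
    _ = s := hxy
end

section
/- Dependency bounds for the sum of two random variables: let X and Y be real-valued random variables on a common probability space with CDFs F_X and F_Y. Then for every s ∈ ℝ, P(X + Y ≤ s) ≥ sup over x ∈ ℝ of max(F_X(x) + F_Y(s − x) − 1, 0), and P(X + Y < s) ≤ inf over x ∈ ℝ of min(F_X(x) + F_Y(s − x), 1). -/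
open MeasureTheory

/-- Dependency bounds for the sum of two random variables:
`P(X + Y ≤ s) ≥ sup_x max (F_X x + F_Y (s - x) - 1) 0` and
`P(X + Y < s) ≤ inf_x min (F_X x + F_Y (s - x)) 1`,
for an arbitrary joint distribution of `X` and `Y`. -/
theorem dependency_bounds_sum {Ω : Type*} [MeasurableSpace Ω]
    (μ : Measure Ω) [IsProbabilityMeasure μ]
    (X Y : Ω → ℝ) (hX : Measurable X) (hY : Measurable Y) (s : ℝ) :
    (⨆ x : ℝ, max ((μ {ω | X ω ≤ x}).toReal + (μ {ω | Y ω ≤ s - x}).toReal - 1) 0)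
        ≤ (μ {ω | X ω + Y ω ≤ s}).toReal ∧
      (μ {ω | X ω + Y ω < s}).toReal
        ≤ ⨅ x : ℝ, min ((μ {ω | X ω ≤ x}).toReal + (μ {ω | Y ω ≤ s - x}).toReal) 1 := by
  refine ⟨ciSup_le fun x => max_le ?_ ENNReal.toReal_nonneg,
    le_ciInf fun x => le_min ?_ measureReal_le_one⟩
  · have hB : MeasurableSet {ω | Y ω ≤ s - x} := measurableSet_le hY measurable_const
    have h_union : μ.real ({ω | X ω ≤ x} ∪ {ω | Y ω ≤ s - x}) ≤ 1 := measureReal_le_one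
    have h_inter : μ.real ({ω | X ω ≤ x} ∩ {ω | Y ω ≤ s - x}) ≤ μ.real {ω | X ω + Y ω ≤ s} :=
      measureReal_mono fun ω ⟨hx, hy⟩ => by
        simp only [Set.mem_ofPred_eq] at hx hy ⊢
        linarith
    have h_add := measureReal_union_add_inter (μ := μ) (s := {ω | X ω ≤ x}) hB
    simp only [← measureReal_def]
    linarith
  · refine (measureReal_mono fun ω hω => ?_).trans
      (measureReal_union_le (μ := μ) {ω | X ω ≤ x} {ω | Y ω ≤ s - x})
    simp only [Set.mem_union, Set.mem_ofPred_eq] at hω ⊢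
    by_contra! h
    linarith [h.1, h.2]
end

section
/- Explicit lower dependency bound for the sum of two uniform random variables: let a < b and c < d be real numbers, and let F_X(x) = min(max((x − a)/(b − a), 0), 1) and F_Y(y) = min(max((y − c)/(d − c), 0), 1) be the CDFs of the uniform distributions on [a,b] and [c,d]. Then for every s ∈ ℝ, sup over x ∈ ℝ of max(F_X(x) + F_Y(s − x) − 1, 0) = min(max((s − m)/((b + d) − m), 0), 1), where m = min(a + d, b + c); i.e., the lower bound is the CDF of a uniform distribution on [min(a + d, b + c), b + d]. -/
/-- The clamped sum bound behind the lower dependency bound, for a slope ratio `r ≤ 1`. -/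
lemma clamp_add_clamp_sub_one_le {X Y r : ℝ} (hr : 0 ≤ r) (hr1 : r ≤ 1) :
    min (max X 0) 1 + min (max Y 0) 1 - 1 ≤ min (max (Y + r * (X - 1)) 0) 1 := by
  have hX : min (max X 0) 1 ≤ 1 := min_le_right _ _
  have hY : min (max Y 0) 1 ≤ 1 := min_le_right _ _
  refine le_min ?_ (by linarith)
  rcases le_total X 0 with h | h
  · rw [max_eq_right h, min_eq_left zero_le_one]
    exact le_max_of_le_right (by linarith)
  rcases le_total Y 0 with h' | h'
  · rw [max_eq_right h', min_eq_left zero_le_one]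
    exact le_max_of_le_right (by linarith)
  apply le_max_of_le_left
  rw [max_eq_left h, max_eq_left h']
  have hY' : min Y 1 ≤ Y := min_le_left _ _
  rcases le_total X 1 with h1 | h1
  · rw [min_eq_left h1]
    nlinarith
  · rw [min_eq_right h1]
    nlinarith

/-- If `[a, b]` is no longer than `[c, d]`, the uniform CDFs on these intervals satisfy the
pointwise lower dependency bound. -/
lemma uniform_cdf_add_uniform_cdf_sub_one_le {a b c d : ℝ} (hab : a < b) (hcd : c < d)
    (h : b - a ≤ d - c) (x y : ℝ) :
    min (max ((x - a) / (b - a)) 0) 1 + min (max ((y - c) / (d - c)) 0) 1 - 1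
      ≤ min (max ((x + y - (b + c)) / (d - c)) 0) 1 := by
  have hp : 0 < b - a := sub_pos.2 hab
  have hq : 0 < d - c := sub_pos.2 hcd
  have key : (x + y - (b + c)) / (d - c)
      = (y - c) / (d - c) + (b - a) / (d - c) * ((x - a) / (b - a) - 1) := by
    field_simp
    ring
  rw [key]
  exact clamp_add_clamp_sub_one_le (by positivity) ((div_le_one hq).2 h)

/-- A pointwise bounded family attaining its bound has that bound as supremum. -/
lemma ciSup_eq_of_forall_le_of_eq {ι α : Type*} [ConditionallyCompleteLattice α] {f : ι → α}
    {v : α} (i : ι) (hi : f i = v) (h : ∀ j, f j ≤ v) : ⨆ j, f j = v :=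
  IsLUB.csSup_eq (IsGreatest.isLUB ⟨⟨i, hi⟩, Set.forall_mem_range.2 h⟩) ⟨_, i, rfl⟩

/-- Explicit lower dependency bound for the sum of two uniform random variables on `[a,b]`
and `[c,d]`: the pointwise supremum `sup_x max (F_X x + F_Y (s - x) - 1) 0` equals the CDF
of a uniform distribution on `[min (a+d) (b+c), b+d]`. -/
theorem lower_bound_sum_uniform (a b c d : ℝ) (hab : a < b) (hcd : c < d)
    (FX FY : ℝ → ℝ)
    (hFX : ∀ x, FX x = min (max ((x - a) / (b - a)) 0) 1)
    (hFY : ∀ y, FY y = min (max ((y - c) / (d - c)) 0) 1) (s : ℝ) :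
    (⨆ x : ℝ, max (FX x + FY (s - x) - 1) 0)
      = min (max ((s - min (a + d) (b + c)) / ((b + d) - min (a + d) (b + c))) 0) 1 := by
  have hp : 0 < b - a := sub_pos.2 hab
  have hq : 0 < d - c := sub_pos.2 hcd
  have clamp_nonneg (t : ℝ) : 0 ≤ min (max t 0) 1 := le_min (le_max_right _ _) zero_le_one
  rcases le_total (b - a) (d - c) with h | h
  · rw [min_eq_right (by linarith : b + c ≤ a + d), show b + d - (b + c) = d - c by ring]
    refine ciSup_eq_of_forall_le_of_eq b ?_ fun x ↦ max_le ?_ (clamp_nonneg _)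
    · rw [hFX, hFY, div_self hp.ne', max_eq_left zero_le_one, min_self, add_sub_cancel_left,
        max_eq_left (clamp_nonneg _), sub_sub]
    · simpa [hFX, hFY] using uniform_cdf_add_uniform_cdf_sub_one_le hab hcd h x (s - x)
  · rw [min_eq_left (by linarith : a + d ≤ b + c), show b + d - (a + d) = b - a by ring]
    refine ciSup_eq_of_forall_le_of_eq (s - d) ?_ fun x ↦ max_le ?_ (clamp_nonneg _)
    · rw [hFX, hFY, sub_sub_cancel, div_self hq.ne', max_eq_left zero_le_one, min_self,
        add_sub_cancel_right, max_eq_left (clamp_nonneg _), sub_sub, add_comm d a]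
    · have := uniform_cdf_add_uniform_cdf_sub_one_le hcd hab h (s - x) x
      rw [sub_add_cancel, add_comm d a] at this
      rw [hFX, hFY]
      linarith
end

section
/- Explicit upper dependency bound for the sum of two uniform random variables: let a < b and c < d be real numbers, and let F_X(x) = min(max((x − a)/(b − a), 0), 1) and F_Y(y) = min(max((y − c)/(d − c), 0), 1) be the CDFs of the uniform distributions on [a,b] and [c,d]. Then for every s ∈ ℝ, inf over x ∈ ℝ of min(F_X(x) + F_Y(s − x), 1) = min(max((s − (a + c))/(M − (a + c)), 0), 1), where M = max(a + d, b + c); i.e., the upper bound is the CDF of a uniform distribution on [a + c, max(a + d, b + c)]. -/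
/-- Clamping to `[0, 1]` is subadditive. -/
theorem clamp_add_le (u v : ℝ) :
    min (max (u + v) 0) 1 ≤ min (max u 0) 1 + min (max v 0) 1 := by
  grind

/-- The uniform CDF on an interval starting at a fixed point decreases with the length. -/
theorem clamp_div_anti {p q : ℝ} (hp : 0 < p) (hpq : p ≤ q) (t : ℝ) :
    min (max (t / q) 0) 1 ≤ min (max (t / p) 0) 1 := by
  refine min_le_min_right _ (max_le ?_ (le_max_right _ _))
  rcases le_total 0 t with ht | ht
  · exact le_max_of_le_left (div_le_div_of_nonneg_left ht hp hpq)
  · exact le_max_of_le_right (div_nonpos_of_nonpos_of_nonneg ht (hp.le.trans hpq))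

/-- Explicit upper dependency bound for the sum of two uniform random variables on `[a,b]`
and `[c,d]`: the pointwise infimum `inf_x min (F_X x + F_Y (s - x)) 1` equals the CDF
of a uniform distribution on `[a+c, max (a+d) (b+c)]`. -/
theorem upper_bound_sum_uniform (a b c d : ℝ) (hab : a < b) (hcd : c < d)
    (FX FY : ℝ → ℝ)
    (hFX : ∀ x, FX x = min (max ((x - a) / (b - a)) 0) 1)
    (hFY : ∀ y, FY y = min (max ((y - c) / (d - c)) 0) 1) (s : ℝ) :
    (⨅ x : ℝ, min (FX x + FY (s - x)) 1)
      = min (max ((s - (a + c)) / (max (a + d) (b + c) - (a + c))) 0) 1 := by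
  have hM : max (a + d) (b + c) - (a + c) = max (b - a) (d - c) := by grind
  rw [hM]
  have lower (x : ℝ) : min (max ((s - (a + c)) / max (b - a) (d - c)) 0) 1
      ≤ min (FX x + FY (s - x)) 1 := by
    refine le_min ?_ (min_le_right _ _)
    have hsum : (s - (a + c)) / max (b - a) (d - c)
        = (x - a) / max (b - a) (d - c) + (s - x - c) / max (b - a) (d - c) := by ring
    rw [hsum, hFX, hFY]
    exact (clamp_add_le _ _).trans (add_le_add
      (clamp_div_anti (sub_pos.2 hab) (le_max_left _ _) _)
      (clamp_div_anti (sub_pos.2 hcd) (le_max_right _ _) _))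
  refine le_antisymm ?_ (le_ciInf lower)
  have bdd : BddBelow (Set.range fun x : ℝ => min (FX x + FY (s - x)) 1) :=
    ⟨_, Set.forall_mem_range.2 lower⟩
  rcases le_total (d - c) (b - a) with h | h
  · refine ciInf_le_of_le bdd (s - c) ((min_le_left _ _).trans_eq ?_)
    rw [hFX, hFY, max_eq_left h, sub_sub_cancel, sub_self, sub_sub, add_comm c a]
    simp
  · refine ciInf_le_of_le bdd a ((min_le_left _ _).trans_eq ?_)
    rw [hFX, hFY, max_eq_right h, sub_self, sub_sub]
    simp
end

section
/- Explicit lower dependency bound for the sum of two exponential random variables: let α, β > 0 and let F_X(x) = 1 − exp(−x/α) for x ≥ 0 and F_X(x) = 0 for x < 0, and F_Y(y) = 1 − exp(−y/β) for y ≥ 0 and F_Y(y) = 0 for y < 0, be the CDFs of exponential distributions with means α and β. Then for every s ∈ ℝ, sup over x ∈ ℝ of max(F_X(x) + F_Y(s − x) − 1, 0) = max(1 − exp(−(s − k)/(α + β)), 0), where k = (α + β)·log(α + β) − β·log β − α·log α; i.e., the lower bound is the CDF of an exponential distribution with mean α + β shifted by k. -/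
theorem exp_le_exp_neg_div_add_exp_neg_div {α β : ℝ} (hα : 0 < α) (hβ : 0 < β) (x y : ℝ) :
    Real.exp (-(x + y - ((α + β) * Real.log (α + β) - β * Real.log β - α * Real.log α)) / (α + β))
      ≤ Real.exp (-x / α) + Real.exp (-y / β) := by
  have hγ : 0 < α + β := add_pos hα hβ
  set t := -(x + y - ((α + β) * Real.log (α + β) - β * Real.log β - α * Real.log α)) / (α + β)
    with ht
  have tangent (c z : ℝ) (hc : 0 < c) :
      c / (α + β) * (Real.exp t * (1 + (Real.log (α + β) - Real.log c - z / c - t)))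
        ≤ Real.exp (-z / c) := by
    have hz : Real.exp (-z / c)
        = c / (α + β) * (Real.exp t * Real.exp (Real.log (α + β) - Real.log c - z / c - t)) := by
      rw [← Real.exp_add, show t + (Real.log (α + β) - Real.log c - z / c - t)
        = Real.log (α + β) - Real.log c + -z / c by ring, Real.exp_add, Real.exp_sub,
        Real.exp_log hγ, Real.exp_log hc]
      field_simp
    rw [hz]
    gcongr
    linarith [Real.add_one_le_exp (Real.log (α + β) - Real.log c - z / c - t)]
  have hsum : α / (α + β) * (Real.exp t * (1 + (Real.log (α + β) - Real.log α - x / α - t)))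
      + β / (α + β) * (Real.exp t * (1 + (Real.log (α + β) - Real.log β - y / β - t)))
      = Real.exp t := by
    have hmul : t * (α + β)
        = -(x + y - ((α + β) * Real.log (α + β) - β * Real.log β - α * Real.log α)) := by
      rw [ht, div_mul_cancel₀ _ hγ.ne']
    clear_value t
    field_simp
    linear_combination -hmul
  linarith [tangent α x hα, tangent β y hβ]

/-- Explicit lower dependency bound for the sum of two exponential random variables with
means `α` and `β`: the pointwise supremum `sup_x max (F_X x + F_Y (s - x) - 1) 0` equals
`max (1 - exp (-(s - k)/(α + β))) 0` with `k = (α+β) log (α+β) - β log β - α log α`,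
i.e. the CDF of an exponential distribution with mean `α + β` shifted by `k`. -/
theorem lower_bound_sum_exponential (α β : ℝ) (hα : 0 < α) (hβ : 0 < β)
    (FX FY : ℝ → ℝ)
    (hFX : ∀ x, FX x = if x < 0 then 0 else 1 - Real.exp (-x / α))
    (hFY : ∀ y, FY y = if y < 0 then 0 else 1 - Real.exp (-y / β))
    (k : ℝ) (hk : k = (α + β) * Real.log (α + β) - β * Real.log β - α * Real.log α)
    (s : ℝ) :
    (⨆ x : ℝ, max (FX x + FY (s - x) - 1) 0)
      = max (1 - Real.exp (-(s - k) / (α + β))) 0 := by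
  subst hk
  have hγ : 0 < α + β := add_pos hα hβ
  set k := (α + β) * Real.log (α + β) - β * Real.log β - α * Real.log α with hk
  have hX_le (x : ℝ) : FX x ≤ 1 := by
    rw [hFX]; split_ifs <;> linarith [Real.exp_pos (-x / α)]
  have hY_le (y : ℝ) : FY y ≤ 1 := by
    rw [hFY]; split_ifs <;> linarith [Real.exp_pos (-y / β)]
  have hle (x : ℝ) : max (FX x + FY (s - x) - 1) 0
      ≤ max (1 - Real.exp (-(s - k) / (α + β))) 0 := by
    refine max_le ?_ (le_max_right _ _)
    by_cases hx : x < 0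
    · have h0 : FX x = 0 := by rw [hFX, if_pos hx]
      exact le_max_of_le_right (by linarith [hY_le (s - x)])
    by_cases hy : s - x < 0
    · have h0 : FY (s - x) = 0 := by rw [hFY, if_pos hy]
      exact le_max_of_le_right (by linarith [hX_le x])
    · refine le_max_of_le_left ?_
      have h := exp_le_exp_neg_div_add_exp_neg_div hα hβ x (s - x)
      rw [add_sub_cancel, ← hk] at h
      rw [hFX, hFY, if_neg hx, if_neg hy]
      linarith
  refine le_antisymm (ciSup_le hle) (max_le ?_ (Real.iSup_nonneg fun _ => le_max_right _ _))
  rcases lt_or_ge s k with hs | hs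
  · refine le_trans ?_ (Real.iSup_nonneg fun _ => le_max_right _ _)
    have h : 0 ≤ -(s - k) / (α + β) := div_nonneg (by linarith) hγ.le
    linarith [Real.one_le_exp h]
  · set t := -(s - k) / (α + β) with ht
    have ht0 : t ≤ 0 := div_nonpos_of_nonpos_of_nonneg (by linarith) hγ.le
    have hmul : t * (α + β) = -(s - k) := by rw [ht, div_mul_cancel₀ _ hγ.ne']
    have hlogα : Real.log α ≤ Real.log (α + β) := Real.log_le_log hα (by linarith)
    have hlogβ : Real.log β ≤ Real.log (α + β) := Real.log_le_log hβ (by linarith)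
    have exp_opt (c : ℝ) (hc : 0 < c) :
        Real.exp (-(c * (Real.log (α + β) - Real.log c - t)) / c)
          = c / (α + β) * Real.exp t := by
      rw [show -(c * (Real.log (α + β) - Real.log c - t)) / c
        = Real.log c - Real.log (α + β) + t by field_simp; ring, Real.exp_add, Real.exp_sub,
        Real.exp_log hγ, Real.exp_log hc]
    have hy : s - α * (Real.log (α + β) - Real.log α - t)
        = β * (Real.log (α + β) - Real.log β - t) := by
      rw [hk] at hmul
      linear_combination hmul
    have hbdd : BddAbove (Set.range fun x : ℝ => max (FX x + FY (s - x) - 1) 0) :=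
      ⟨_, Set.forall_mem_range.2 hle⟩
    refine le_trans ?_ (le_ciSup hbdd (α * (Real.log (α + β) - Real.log α - t)))
    refine le_max_of_le_left (le_of_eq ?_)
    rw [hy, hFX, hFY, if_neg (not_lt.2 (mul_nonneg hα.le (by linarith))),
      if_neg (not_lt.2 (mul_nonneg hβ.le (by linarith))), exp_opt α hα, exp_opt β hβ]
    field_simp
    ring
end

section
/- Explicit upper dependency bound for the sum of two exponential random variables: let α, β > 0 and let F_X(x) = 1 − exp(−x/α) for x ≥ 0 and F_X(x) = 0 for x < 0, and F_Y(y) = 1 − exp(−y/β) for y ≥ 0 and F_Y(y) = 0 for y < 0, be the CDFs of exponential distributions with means α and β. Then for every s ≥ 0, inf over x ∈ [0, s] of min(F_X(x) + F_Y(s − x), 1) = min(F_X(s), F_Y(s)) = 1 − exp(−s/max(α, β)); i.e., the upper bound is the CDF of an exponential distribution with mean max(α, β). -/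
open Set

theorem one_sub_exp_neg_div_anti {a b x : ℝ} (ha : 0 < a) (hab : a ≤ b) (hx : 0 ≤ x) :
    1 - Real.exp (-x / b) ≤ 1 - Real.exp (-x / a) := by
  have h : x / b ≤ x / a := div_le_div_of_nonneg_left hx ha hab
  have : Real.exp (-x / a) ≤ Real.exp (-x / b) := by
    rw [neg_div, neg_div]
    exact Real.exp_le_exp.2 (neg_le_neg h)
  linarith

theorem one_sub_exp_neg_div_subadd {m x y : ℝ} (hm : 0 < m) (hx : 0 ≤ x) (hy : 0 ≤ y) :
    1 - Real.exp (-(x + y) / m) ≤ (1 - Real.exp (-x / m)) + (1 - Real.exp (-y / m)) := by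
  have hle {z : ℝ} (hz : 0 ≤ z) : Real.exp (-z / m) ≤ 1 :=
    Real.exp_le_one_iff.2 (div_nonpos_of_nonpos_of_nonneg (neg_nonpos.2 hz) hm.le)
  have hmul : Real.exp (-(x + y) / m) = Real.exp (-x / m) * Real.exp (-y / m) := by
    rw [← Real.exp_add]
    ring_nf
  nlinarith [mul_nonneg (sub_nonneg.2 (hle hx)) (sub_nonneg.2 (hle hy))]

/-- Explicit upper dependency bound for the sum of two exponential random variables with
means `α` and `β`: for `s ≥ 0`, the pointwise infimum over `x ∈ [0, s]` of
`min (F_X x + F_Y (s - x)) 1` equals `min (F_X s) (F_Y s) = 1 - exp (-s / max α β)`,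
i.e. the CDF of an exponential distribution with mean `max α β`. -/
theorem upper_bound_sum_exponential (α β : ℝ) (hα : 0 < α) (hβ : 0 < β)
    (FX FY : ℝ → ℝ)
    (hFX : ∀ x, FX x = if x < 0 then 0 else 1 - Real.exp (-x / α))
    (hFY : ∀ y, FY y = if y < 0 then 0 else 1 - Real.exp (-y / β))
    (s : ℝ) (hs : 0 ≤ s) :
    (⨅ x : Icc (0:ℝ) s, min (FX x + FY (s - x)) 1) = min (FX s) (FY s) ∧
      min (FX s) (FY s) = 1 - Real.exp (-s / max α β) := by
  have hX {x : ℝ} (hx : 0 ≤ x) : FX x = 1 - Real.exp (-x / α) := by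
    rw [hFX, if_neg hx.not_gt]
  have hY {y : ℝ} (hy : 0 ≤ y) : FY y = 1 - Real.exp (-y / β) := by
    rw [hFY, if_neg hy.not_gt]
  have hmin : min (FX s) (FY s) = 1 - Real.exp (-s / max α β) := by
    rw [hX hs, hY hs]
    rcases le_total α β with h | h
    · rw [max_eq_right h, min_eq_right (one_sub_exp_neg_div_anti hα h hs)]
    · rw [max_eq_left h, min_eq_left (one_sub_exp_neg_div_anti hβ h hs)]
  refine ⟨?_, hmin⟩
  have hlower (x : Icc (0:ℝ) s) : min (FX s) (FY s) ≤ min (FX x + FY (s - x)) 1 := by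
    obtain ⟨x, hx0, hxs⟩ := x
    have hy : 0 ≤ s - x := sub_nonneg.2 hxs
    rw [hmin]
    refine le_min ?_ (sub_le_self 1 (Real.exp_pos _).le)
    have h := one_sub_exp_neg_div_subadd (lt_max_of_lt_left hα : 0 < max α β) hx0 hy
    rw [add_sub_cancel] at h
    have h₁ := one_sub_exp_neg_div_anti hα (le_max_left α β) hx0
    have h₂ := one_sub_exp_neg_div_anti hβ (le_max_right α β) hy
    dsimp only
    rw [hX hx0, hY hy]
    linarith
  have hbdd : BddBelow (range fun x : Icc (0:ℝ) s => min (FX x + FY (s - x)) 1) :=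
    ⟨_, forall_mem_range.2 hlower⟩
  have : Nonempty (Icc (0:ℝ) s) := ⟨⟨0, le_rfl, hs⟩⟩
  refine le_antisymm (le_min ?_ ?_) (le_ciInf hlower)
  · refine (ciInf_le hbdd ⟨s, hs, le_rfl⟩).trans ((min_le_left _ _).trans ?_)
    simp [hY le_rfl]
  · refine (ciInf_le hbdd ⟨0, le_rfl, hs⟩).trans ((min_le_left _ _).trans ?_)
    simp [hX le_rfl]
end

section
/- Worst-case outage probability for a point-to-point channel over two dependent Rayleigh fading links: let X and Y be random variables on a common probability space such that X is exponentially distributed with mean α > 0 and Y is exponentially distributed with mean β > 0 (with arbitrary joint distribution). Then for every s ∈ ℝ, P(X + Y ≤ s) ≥ max(1 − exp(−(s − k)/(α + β)), 0), where k = (α + β)·log(α + β) − β·log β − α·log α. -/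
open MeasureTheory

/-- Bonferroni lower bound: `P(X + Y ≤ x + y) ≥ P(X ≤ x) + P(Y ≤ y) - 1`. -/
theorem measureReal_add_sub_one_le_measureReal_add_le {Ω : Type*} [MeasurableSpace Ω]
    (μ : Measure Ω) [IsProbabilityMeasure μ] {X Y : Ω → ℝ} (hY : Measurable Y) (x y : ℝ) :
    μ.real {ω | X ω ≤ x} + μ.real {ω | Y ω ≤ y} - 1 ≤ μ.real {ω | X ω + Y ω ≤ x + y} := by
  have hmeas : MeasurableSet {ω | Y ω ≤ y} := measurableSet_le hY measurable_const
  have hsplit := measureReal_union_add_inter (μ := μ) (s := {ω | X ω ≤ x}) hmeas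
  have hunion : μ.real ({ω | X ω ≤ x} ∪ {ω | Y ω ≤ y}) ≤ 1 := measureReal_le_one
  have hinter : μ.real ({ω | X ω ≤ x} ∩ {ω | Y ω ≤ y}) ≤ μ.real {ω | X ω + Y ω ≤ x + y} :=
    measureReal_mono fun ω ⟨hx, hy⟩ =>
      show X ω + Y ω ≤ x + y from add_le_add hx hy
  linarith

theorem one_sub_exp_le_exponential_cdf {a : ℝ} (ha : 0 < a) (x : ℝ) :
    1 - Real.exp (-x / a) ≤ if x < 0 then 0 else 1 - Real.exp (-x / a) := by
  split_ifs with hx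
  · have : 1 ≤ Real.exp (-x / a) :=
      Real.one_le_exp (div_nonneg (neg_nonneg.mpr hx.le) ha.le)
    linarith
  · exact le_rfl

/-- Worst-case outage probability for a point-to-point channel over two dependent
Rayleigh fading links: if `X` and `Y` are exponentially distributed with means `α` and `β`
(arbitrary joint distribution), then for every `s`,
`P(X + Y ≤ s) ≥ max (1 - exp (-(s - k)/(α + β))) 0` with
`k = (α+β) log (α+β) - β log β - α log α`. -/
theorem worst_case_outage_sum_exponential {Ω : Type*} [MeasurableSpace Ω]
    (μ : Measure Ω) [IsProbabilityMeasure μ]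
    (X Y : Ω → ℝ) (hX : Measurable X) (hY : Measurable Y)
    (α β : ℝ) (hα : 0 < α) (hβ : 0 < β)
    (hFX : ∀ x, (μ {ω | X ω ≤ x}).toReal = if x < 0 then 0 else 1 - Real.exp (-x / α))
    (hFY : ∀ y, (μ {ω | Y ω ≤ y}).toReal = if y < 0 then 0 else 1 - Real.exp (-y / β))
    (k : ℝ) (hk : k = (α + β) * Real.log (α + β) - β * Real.log β - α * Real.log α)
    (s : ℝ) :
    max (1 - Real.exp (-(s - k) / (α + β))) 0 ≤ (μ {ω | X ω + Y ω ≤ s}).toReal := by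
  refine max_le ?_ ENNReal.toReal_nonneg
  have hαβ : 0 < α + β := add_pos hα hβ
  set u := -(s - k) / (α + β) with hu
  set x := -(α * (Real.log α - Real.log (α + β) + u)) with hx
  set y := -(β * (Real.log β - Real.log (α + β) + u)) with hy
  have hsum : x + y = s := by
    have hu' : (α + β) * u = -(s - k) := mul_div_cancel₀ _ hαβ.ne'
    linear_combination -hu' - hk
  have hexpx : Real.exp (-x / α) = α / (α + β) * Real.exp u := by
    rw [hx, neg_neg, mul_div_cancel_left₀ _ hα.ne', Real.exp_add, Real.exp_sub,
      Real.exp_log hα, Real.exp_log hαβ]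
  have hexpy : Real.exp (-y / β) = β / (α + β) * Real.exp u := by
    rw [hy, neg_neg, mul_div_cancel_left₀ _ hβ.ne', Real.exp_add, Real.exp_sub,
      Real.exp_log hβ, Real.exp_log hαβ]
  have hexp : Real.exp (-x / α) + Real.exp (-y / β) = Real.exp u := by
    rw [hexpx, hexpy, ← add_mul, ← add_div, div_self hαβ.ne', one_mul]
  have hbound := measureReal_add_sub_one_le_measureReal_add_le μ (X := X) hY x y
  rw [hsum] at hbound
  simp only [Measure.real] at hbound
  have hcdfx := one_sub_exp_le_exponential_cdf hα x
  have hcdfy := one_sub_exp_le_exponential_cdf hβ y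
  rw [← hFX] at hcdfx
  rw [← hFY] at hcdfy
  linarith
end

section
/- Attainability of the lower dependency bound for the sum of two standard uniform random variables: let U be uniformly distributed on [0,1] and let s ∈ [1,2]. Define X = U and Y = s − 1 − U if U < s − 1, and Y = s − U if U ≥ s − 1. Then Y is uniformly distributed on [0,1], and P(X + Y < s) = s − 1; i.e., this coupling attains the pointwise lower Fréchet–Hoeffding bound sup_x max(F_X(x) + F_Y(s − x) − 1, 0) = s − 1 for the sum of two standard uniform marginals at the point s. -/
open MeasureTheory

/-- For a standard uniform random variable, the CDF also gives the probability of strict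
sublevel sets. -/
lemma measureReal_lt_of_uniform_cdf {Ω : Type*} [MeasurableSpace Ω]
    (μ : Measure Ω) [IsProbabilityMeasure μ] (U : Ω → ℝ)
    (hUcdf : ∀ u, μ.real {ω | U ω ≤ u} = min (max u 0) 1) (u : ℝ) :
    μ.real {ω | U ω < u} = min (max u 0) 1 := by
  apply le_antisymm
  · rw [← hUcdf u]
    exact measureReal_mono fun ω (h : U ω < u) => h.le
  · refine le_of_forall_pos_le_add fun ε hε => ?_
    have h : μ.real {ω | U ω ≤ u - ε} ≤ μ.real {ω | U ω < u} :=
      measureReal_mono fun ω (h : U ω ≤ u - ε) => show U ω < u by linarith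
    rw [hUcdf] at h
    grind

/-- The probability that a standard uniform random variable lies in `[c, d)`. -/
lemma measureReal_Ico_of_uniform_cdf {Ω : Type*} [MeasurableSpace Ω]
    (μ : Measure Ω) [IsProbabilityMeasure μ] (U : Ω → ℝ) (hU : Measurable U)
    (hUcdf : ∀ u, μ.real {ω | U ω ≤ u} = min (max u 0) 1) {c d : ℝ} (hcd : c ≤ d) :
    μ.real {ω | c ≤ U ω ∧ U ω < d} = min (max d 0) 1 - min (max c 0) 1 := by
  have hset : {ω | c ≤ U ω ∧ U ω < d} = {ω | U ω < d} \ {ω | U ω < c} := by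
    ext ω
    simp [and_comm]
  have hsub : {ω | U ω < c} ⊆ {ω | U ω < d} := fun ω (h : U ω < c) => h.trans_le hcd
  rw [hset, measureReal_sdiff hsub (measurableSet_lt hU measurable_const),
    measureReal_lt_of_uniform_cdf μ U hUcdf, measureReal_lt_of_uniform_cdf μ U hUcdf]

/-- The probability that a standard uniform random variable is at least `c`. -/
lemma measureReal_ge_of_uniform_cdf {Ω : Type*} [MeasurableSpace Ω]
    (μ : Measure Ω) [IsProbabilityMeasure μ] (U : Ω → ℝ) (hU : Measurable U)
    (hUcdf : ∀ u, μ.real {ω | U ω ≤ u} = min (max u 0) 1) (c : ℝ) :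
    μ.real {ω | c ≤ U ω} = 1 - min (max c 0) 1 := by
  have hset : {ω | c ≤ U ω} = {ω | U ω < c}ᶜ := by
    ext ω
    simp
  rw [hset, probReal_compl_eq_one_sub (measurableSet_lt hU measurable_const),
    measureReal_lt_of_uniform_cdf μ U hUcdf]

/-- Attainability of the lower dependency bound for the sum of two standard uniform
random variables: for `U` uniform on `[0,1]` and `s ∈ [1,2]`, the coupling `X = U`,
`Y = s - 1 - U` if `U < s - 1` and `Y = s - U` otherwise, has `Y` uniform on `[0,1]`
and `P(X + Y < s) = s - 1`, attaining the pointwise lower Fréchet–Hoeffding bound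
`sup_x max (F_X x + F_Y (s - x) - 1) 0 = s - 1`. -/
theorem lower_bound_attained_uniform_sum {Ω : Type*} [MeasurableSpace Ω]
    (μ : Measure Ω) [IsProbabilityMeasure μ]
    (U : Ω → ℝ) (hU : Measurable U)
    (hUcdf : ∀ u, (μ {ω | U ω ≤ u}).toReal = min (max u 0) 1)
    (s : ℝ) (hs : s ∈ Set.Icc (1:ℝ) 2)
    (X Y : Ω → ℝ) (hXdef : ∀ ω, X ω = U ω)
    (hYdef : ∀ ω, Y ω = if U ω < s - 1 then s - 1 - U ω else s - U ω) :
    (∀ u, (μ {ω | Y ω ≤ u}).toReal = min (max u 0) 1) ∧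
      (μ {ω | X ω + Y ω < s}).toReal = s - 1 ∧
      (⨆ x : ℝ, max (min (max x 0) 1 + min (max (s - x) 0) 1 - 1) 0) = s - 1 := by
  obtain ⟨hs1, hs2⟩ := hs
  change ∀ u, μ.real {ω | U ω ≤ u} = _ at hUcdf
  refine ⟨fun u => ?_, ?_, ?_⟩
  · change μ.real {ω | Y ω ≤ u} = _
    have hset : {ω | Y ω ≤ u} = {ω | min (s - 1 - u) (s - 1) ≤ U ω ∧ U ω < s - 1 ∧ 0 ≤ u} ∪
        {ω | max (s - 1) (s - u) ≤ U ω} := by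
      ext ω
      simp only [Set.mem_ofPred_eq, Set.mem_union, hYdef]
      grind
    have hdisj : Disjoint {ω | min (s - 1 - u) (s - 1) ≤ U ω ∧ U ω < s - 1 ∧ 0 ≤ u}
        {ω | max (s - 1) (s - u) ≤ U ω} := by
      refine Set.disjoint_left.2 fun ω h h' => ?_
      simp only [Set.mem_ofPred_eq] at h h'
      grind
    rw [hset, measureReal_union hdisj (measurableSet_le measurable_const hU),
      measureReal_ge_of_uniform_cdf μ U hU hUcdf]
    by_cases hu : 0 ≤ u
    · simp only [hu, and_true]
      rw [measureReal_Ico_of_uniform_cdf μ U hU hUcdf (min_le_right _ _)]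
      clear hset hdisj hUcdf hXdef hYdef
      grind
    · simp only [hu, and_false, Set.ofPred_false, measureReal_empty]
      grind
  · change μ.real {ω | X ω + Y ω < s} = _
    have hset : {ω | X ω + Y ω < s} = {ω | U ω < s - 1} := by
      ext ω
      simp only [Set.mem_ofPred_eq, hXdef, hYdef]
      grind
    rw [hset, measureReal_lt_of_uniform_cdf μ U hUcdf]
    grind
  · have hle : ∀ x : ℝ, max (min (max x 0) 1 + min (max (s - x) 0) 1 - 1) 0 ≤ s - 1 := by
      intro x
      grind
    refine le_antisymm (ciSup_le hle) ?_
    refine le_ciSup_of_le ⟨s - 1, Set.forall_mem_range.2 hle⟩ 1 ?_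
    grind
end

section
/- Attainability of the upper dependency bound for the sum of two standard uniform random variables: let U be uniformly distributed on [0,1] and let s ∈ [0,1]. Define X = U and Y = s − U if U ≤ s, and Y = U if U > s. Then Y is uniformly distributed on [0,1], and P(X + Y ≤ s) = s; i.e., this coupling attains the pointwise upper Fréchet–Hoeffding bound inf_x min(F_X(x) + F_Y(s − x), 1) = s for the sum of two standard uniform marginals at the point s. -/
open MeasureTheory

/-- The probability of a closed interval under a real law with a continuous distribution
function. -/
theorem measureReal_Icc_of_continuous_cdf (ν : Measure ℝ) [IsProbabilityMeasure ν]
    (hc : Continuous (ProbabilityTheory.cdf ν)) {a b : ℝ} (hab : a ≤ b) :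
    ν.real (Set.Icc a b) = ProbabilityTheory.cdf ν b - ProbabilityTheory.cdf ν a := by
  conv_lhs => rw [← ProbabilityTheory.measure_cdf ν]
  rw [measureReal_def, StieltjesFunction.measure_Icc,
    hc.continuousAt.continuousWithinAt.leftLim_eq,
    ENNReal.toReal_ofReal (sub_nonneg.2 (ProbabilityTheory.monotone_cdf ν hab))]

/-- Attainability of the upper dependency bound for the sum of two standard uniform
random variables: for `U` uniform on `[0,1]` and `s ∈ [0,1]`, the coupling `X = U`,
`Y = s - U` if `U ≤ s` and `Y = U` otherwise, has `Y` uniform on `[0,1]`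
and `P(X + Y ≤ s) = s`, attaining the pointwise upper Fréchet–Hoeffding bound
`inf_x min (F_X x + F_Y (s - x)) 1 = s`. -/
theorem upper_bound_attained_uniform_sum {Ω : Type*} [MeasurableSpace Ω]
    (μ : Measure Ω) [IsProbabilityMeasure μ]
    (U : Ω → ℝ) (hU : Measurable U)
    (hUcdf : ∀ u, (μ {ω | U ω ≤ u}).toReal = min (max u 0) 1)
    (s : ℝ) (hs : s ∈ Set.Icc (0:ℝ) 1)
    (X Y : Ω → ℝ) (hXdef : ∀ ω, X ω = U ω)
    (hYdef : ∀ ω, Y ω = if U ω ≤ s then s - U ω else U ω) :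
    (∀ u, (μ {ω | Y ω ≤ u}).toReal = min (max u 0) 1) ∧
      (μ {ω | X ω + Y ω ≤ s}).toReal = s ∧
      (⨅ x : ℝ, min (min (max x 0) 1 + min (max (s - x) 0) 1) 1) = s := by
  obtain ⟨hs0, hs1⟩ := hs
  refine ⟨fun u => ?_, ?_, ?_⟩
  · rcases lt_or_ge u 0 with hu | hu
    · have hempty : {ω | Y ω ≤ u} = ∅ := by
        ext ω
        simp only [Set.mem_ofPred_eq, hYdef, Set.mem_empty_iff_false, iff_false, not_le]
        split_ifs <;> linarith
      simp [hempty, hu.le]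
    · have : IsProbabilityMeasure (μ.map U) := Measure.isProbabilityMeasure_map hU.aemeasurable
      have hcdf : ⇑(ProbabilityTheory.cdf (μ.map U)) = fun x => min (max x 0) 1 := by
        ext x
        rw [ProbabilityTheory.cdf_eq_real, map_measureReal_apply hU measurableSet_Iic]
        exact hUcdf x
      have hset : {ω | Y ω ≤ u} = U ⁻¹' Set.Icc (s - u) (max s u) := by
        ext ω
        simp only [Set.mem_ofPred_eq, hYdef, Set.mem_preimage, Set.mem_Icc, le_max_iff]
        grind
      have hle : s - u ≤ max s u := (sub_le_self s hu).trans (le_max_left s u)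
      rw [hset, ← measureReal_def, ← map_measureReal_apply hU measurableSet_Icc,
        measureReal_Icc_of_continuous_cdf _ (by rw [hcdf]; fun_prop) hle, hcdf]
      grind
  · have hset : {ω | X ω + Y ω ≤ s} = {ω | U ω ≤ s} := by
      ext ω
      simp only [Set.mem_ofPred_eq, hXdef, hYdef]
      grind
    rw [hset, hUcdf, max_eq_left hs0, min_eq_left hs1]
  · have hbound (x : ℝ) : s ≤ min (min (max x 0) 1 + min (max (s - x) 0) 1) 1 := by grind
    refine le_antisymm ((ciInf_le ⟨s, Set.forall_mem_range.2 hbound⟩ 0).trans ?_)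
      (le_ciInf hbound)
    grind
end
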